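/- Let Ω₀ = {x ∈ ℝ³ : |x| < 1}, d(x) = (1/4)(1 − |x|²), and let α : [0,∞) → (0,∞) be continuously differentiable with α(0) = 1. Let η : Ω₀ × [0,∞) → ℝ³ be C³ with η(x,0) = x, invertible spatial Jacobian ∇η(x,t) everywhere, v = ∂_t η, u₀ = v(·,0), A = (∇η)⁻¹, J = det ∇η. Suppose the γ = 2 momentum equation holds on Ω₀ × (0,∞): for each i, α⁵ ∂_t vⁱ + 2 α⁴ α' vⁱ + ηⁱ + 2 Aᵏᵢ ∂_k( d · J⁻¹ ) = 0. Then for every t ≥ 0, every x ∈ Ω₀ and each component i: α(t)² (curl_η v)ᵢ(x,t) = (curl u₀)ᵢ(x) + ∫₀ᵗ α(s)² ε_{ikj} ∂_r vᵏ Aʳₗ ∂_m vˡ Aᵐⱼ (x,s) ds (summation over repeated indices). -/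

import Mathlib

open Set Matrix intervalIntegral

noncomputable section

/-- Partial derivative `∂_k f` of a scalar function on `ℝ³` (realized as `Fin 3 → ℝ`). -/
def pd (k : Fin 3) (f : (Fin 3 → ℝ) → ℝ) (x : Fin 3 → ℝ) : ℝ :=
  fderiv ℝ f x (Pi.single k 1)

/-- The open unit ball `Ω₀ = {x ∈ ℝ³ : |x| < 1}` (Euclidean norm). -/
def ball3 : Set (Fin 3 → ℝ) := {x | ∑ i, x i ^ 2 < 1}

/-- The weight function `d(x) = (1/4)(1 − |x|²)`. -/
def dw (x : Fin 3 → ℝ) : ℝ := (1 - ∑ i, x i ^ 2) / 4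

/-- The spatial Jacobian matrix `∇η(·,t)` of a time-dependent map `η`. -/
def jacT (η : (Fin 3 → ℝ) → ℝ → Fin 3 → ℝ) (x : Fin 3 → ℝ) (t : ℝ) :
    Matrix (Fin 3) (Fin 3) ℝ :=
  Matrix.of fun i k => pd k (fun y => η y t i) x

/-- The permutation (Levi-Civita) symbol `ε_{ijk}` on `Fin 3`. -/
def eps (i j k : Fin 3) : ℝ :=
  (((i : ℕ) : ℝ) - ((j : ℕ) : ℝ)) * (((j : ℕ) : ℝ) - ((k : ℕ) : ℝ)) *
    (((k : ℕ) : ℝ) - ((i : ℕ) : ℝ)) / 2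

lemma isOpen_ball3 : IsOpen ball3 :=
  isOpen_lt (by fun_prop) continuous_const

lemma uniqueDiffOn_ball3_prod_Ici : UniqueDiffOn ℝ (ball3 ×ˢ Ici (0 : ℝ)) :=
  isOpen_ball3.uniqueDiffOn.prod (uniqueDiffOn_Ici 0)

lemma ball3_prod_Ici_mem_nhds {x : Fin 3 → ℝ} {t : ℝ} (hx : x ∈ ball3) (ht : 0 < t) :
    ball3 ×ˢ Ici (0 : ℝ) ∈ nhds (x, t) :=
  prod_mem_nhds (isOpen_ball3.mem_nhds hx) (Ici_mem_nhds ht)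

/-- Spatial slices of a function differentiable on the space-time cylinder. -/
lemma hasFDerivAt_slice {g : (Fin 3 → ℝ) × ℝ → ℝ} {x : Fin 3 → ℝ} {t : ℝ}
    (hg : DifferentiableOn ℝ g (ball3 ×ˢ Ici 0)) (hx : x ∈ ball3) (ht : t ∈ Ici (0 : ℝ)) :
    HasFDerivAt (fun y => g (y, t))
      ((fderivWithin ℝ g (ball3 ×ˢ Ici 0) (x, t)).comp
        (ContinuousLinearMap.inl ℝ (Fin 3 → ℝ) ℝ)) x := by
  have h := (hg (x, t) ⟨hx, ht⟩).hasFDerivWithinAt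
  have h2 := h.comp (s := ball3) (f := fun y => (y, t)) x
    (hasFDerivAt_prodMk_left x t).hasFDerivWithinAt (fun y hy => ⟨hy, ht⟩)
  exact h2.hasFDerivAt (isOpen_ball3.mem_nhds hx)

lemma pd_slice {g : (Fin 3 → ℝ) × ℝ → ℝ} {x : Fin 3 → ℝ} {t : ℝ} (k : Fin 3)
    (hg : DifferentiableOn ℝ g (ball3 ×ˢ Ici 0)) (hx : x ∈ ball3) (ht : t ∈ Ici (0 : ℝ)) :
    pd k (fun y => g (y, t)) x
      = fderivWithin ℝ g (ball3 ×ˢ Ici 0) (x, t) (Pi.single k 1, 0) := by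
  simp [pd, (hasFDerivAt_slice hg hx ht).fderiv]

lemma contDiffOn_pd {g : (Fin 3 → ℝ) × ℝ → ℝ} {n : WithTop ℕ∞}
    (hg : ContDiffOn ℝ (n + 1) g (ball3 ×ˢ Ici 0)) (k : Fin 3) :
    ContDiffOn ℝ n (fun p : (Fin 3 → ℝ) × ℝ => pd k (fun y => g (y, p.2)) p.1)
      (ball3 ×ˢ Ici 0) := by
  have h := (hg.fderivWithin uniqueDiffOn_ball3_prod_Ici le_rfl).clm_apply
    (contDiffOn_const (c := ((Pi.single k 1 : Fin 3 → ℝ), (0 : ℝ))))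
  exact h.congr fun p hp => pd_slice k (hg.differentiableOn (by simp)) hp.1 hp.2

lemma timeDeriv_eq {g w : (Fin 3 → ℝ) × ℝ → ℝ}
    (hg : DifferentiableOn ℝ g (ball3 ×ˢ Ici 0))
    (hw : ∀ x ∈ ball3, ∀ t ∈ Ici (0 : ℝ),
      HasDerivWithinAt (fun s => g (x, s)) (w (x, t)) (Ici 0) t)
    {x : Fin 3 → ℝ} {t : ℝ} (hx : x ∈ ball3) (ht : t ∈ Ici (0 : ℝ)) :
    w (x, t) = fderivWithin ℝ g (ball3 ×ˢ Ici 0) (x, t) (0, 1) := by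
  have h := (hg (x, t) ⟨hx, ht⟩).hasFDerivWithinAt
  have h2 := (h.comp t (hasFDerivAt_prodMk_right x t).hasFDerivWithinAt
    (s := Ici 0) (fun y hy => ⟨hx, hy⟩)).hasDerivWithinAt
  simpa using (uniqueDiffOn_Ici (0 : ℝ) t ht).eq_deriv _ (hw x hx t ht) h2

lemma contDiffOn_timeDeriv {g w : (Fin 3 → ℝ) × ℝ → ℝ} {n : WithTop ℕ∞}
    (hg : ContDiffOn ℝ (n + 1) g (ball3 ×ˢ Ici 0))
    (hw : ∀ x ∈ ball3, ∀ t ∈ Ici (0 : ℝ),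
      HasDerivWithinAt (fun s => g (x, s)) (w (x, t)) (Ici 0) t) :
    ContDiffOn ℝ n w (ball3 ×ˢ Ici 0) := by
  have h := (hg.fderivWithin uniqueDiffOn_ball3_prod_Ici le_rfl).clm_apply
    (contDiffOn_const (c := ((0 : Fin 3 → ℝ), (1 : ℝ))))
  exact h.congr fun p hp => timeDeriv_eq (hg.differentiableOn (by simp)) hw hp.1 hp.2

/-- Time derivatives commute with spatial partial derivatives. -/
lemma hasDerivAt_pd {g w : (Fin 3 → ℝ) × ℝ → ℝ}
    (hg : ContDiffOn ℝ 2 g (ball3 ×ˢ Ici 0))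
    (hw : ∀ x ∈ ball3, ∀ t ∈ Ici (0 : ℝ),
      HasDerivWithinAt (fun s => g (x, s)) (w (x, t)) (Ici 0) t)
    (k : Fin 3) {x : Fin 3 → ℝ} {t : ℝ} (hx : x ∈ ball3) (ht : 0 < t) :
    HasDerivAt (fun s => pd k (fun y => g (y, s)) x) (pd k (fun y => w (y, t)) x) t := by
  have hd := hg.differentiableOn (by simp)
  have hfd : ∀ y ∈ ball3, ∀ s, 0 < s →
      fderivWithin ℝ g (ball3 ×ˢ Ici 0) (y, s) = fderiv ℝ g (y, s) := fun y hy s hs =>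
    fderivWithin_of_mem_nhds (ball3_prod_Ici_mem_nhds hy hs)
  have hgt : ContDiffAt ℝ 2 g (x, t) := hg.contDiffAt (ball3_prod_Ici_mem_nhds hx ht)
  have hD := ((hgt.fderiv_right (m := 1) (by norm_num)).differentiableAt (by simp)).hasFDerivAt
  have hsymm := hgt.isSymmSndFDerivAt (by simp)
  have h1 : HasDerivAt (fun s => fderiv ℝ g (x, s) (Pi.single k 1, 0))
      (fderiv ℝ (fderiv ℝ g) (x, t) (0, 1) (Pi.single k 1, 0)) t := by
    have := (hD.comp t (hasFDerivAt_prodMk_right x t)).clm_apply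
      (hasFDerivAt_const ((Pi.single k 1 : Fin 3 → ℝ), (0 : ℝ)) t)
    simpa using this.hasDerivAt
  have h2 : HasFDerivAt (fun y => fderiv ℝ g (y, t) (0, 1))
      (((fderiv ℝ (fderiv ℝ g) (x, t)).comp (ContinuousLinearMap.inl ℝ _ ℝ)).flip (0, 1)) x := by
    have := (hD.comp (f := fun y => (y, t)) x (hasFDerivAt_prodMk_left x t)).clm_apply
      (hasFDerivAt_const ((0 : Fin 3 → ℝ), (1 : ℝ)) x)
    simpa using this
  have h3 : pd k (fun y => w (y, t)) x
      = fderiv ℝ (fderiv ℝ g) (x, t) (0, 1) (Pi.single k 1, 0) := by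
    have he : (fun y => w (y, t)) =ᶠ[nhds x] fun y => fderiv ℝ g (y, t) (0, 1) := by
      filter_upwards [isOpen_ball3.mem_nhds hx] with y hy
      rw [timeDeriv_eq hd hw hy ht.le, hfd y hy t ht]
    rw [pd, he.fderiv_eq, h2.fderiv, hsymm.eq]
    simp
  rw [h3]
  refine h1.congr_of_eventuallyEq ?_
  filter_upwards [Ioi_mem_nhds ht] with s hs
  rw [pd_slice k hd hx (mem_Ici.2 (le_of_lt hs)), hfd x hx s hs]

lemma contDiffAt_slice {g : (Fin 3 → ℝ) × ℝ → ℝ} {n : WithTop ℕ∞}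
    (hg : ContDiffOn ℝ n g (ball3 ×ˢ Ici 0)) {x : Fin 3 → ℝ} {t : ℝ}
    (hx : x ∈ ball3) (ht : t ∈ Ici (0 : ℝ)) : ContDiffAt ℝ n (fun y => g (y, t)) x :=
  (hg.comp (contDiffOn_id.prodMk contDiffOn_const) (fun _ hy => ⟨hy, ht⟩)).contDiffAt
    (isOpen_ball3.mem_nhds hx)

lemma contDiffAt_pd {f : (Fin 3 → ℝ) → ℝ} {x : Fin 3 → ℝ} {n : WithTop ℕ∞}
    (hf : ContDiffAt ℝ (n + 1) f x) (k : Fin 3) : ContDiffAt ℝ n (pd k f) x :=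
  (hf.fderiv_right le_rfl).clm_apply contDiffAt_const

lemma pd_comm {f : (Fin 3 → ℝ) → ℝ} {x : Fin 3 → ℝ} (hf : ContDiffAt ℝ 2 f x) (r s : Fin 3) :
    pd r (pd s f) x = pd s (pd r f) x := by
  have hD := ((hf.fderiv_right (m := 1) (by norm_num)).differentiableAt (by simp)).hasFDerivAt
  have h : ∀ a b : Fin 3, pd a (pd b f) x
      = fderiv ℝ (fderiv ℝ f) x (Pi.single a 1) (Pi.single b 1) := fun a b => by
    have := hD.clm_apply (hasFDerivAt_const (Pi.single b 1 : Fin 3 → ℝ) x)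
    change fderiv ℝ (fun y => fderiv ℝ f y (Pi.single b 1)) x _ = _
    rw [this.fderiv]
    simp
  rw [h, h, (hf.isSymmSndFDerivAt (by simp)).eq]

lemma contDiffOn_det {X : Type*} [NormedAddCommGroup X] [NormedSpace ℝ X] {n : WithTop ℕ∞}
    {s : Set X} {M : X → Matrix (Fin 3) (Fin 3) ℝ}
    (hM : ∀ i j, ContDiffOn ℝ n (fun x => M x i j) s) : ContDiffOn ℝ n (fun x => (M x).det) s := by
  simp only [Matrix.det_apply']
  exact ContDiffOn.sum fun σ _ => contDiffOn_const.mul (contDiffOn_prod fun i _ => hM _ _)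

lemma contDiffOn_inv_apply {X : Type*} [NormedAddCommGroup X] [NormedSpace ℝ X] {n : WithTop ℕ∞}
    {s : Set X} {M : X → Matrix (Fin 3) (Fin 3) ℝ}
    (hM : ∀ i j, ContDiffOn ℝ n (fun x => M x i j) s) (hu : ∀ x ∈ s, IsUnit (M x).det)
    (i j : Fin 3) : ContDiffOn ℝ n (fun x => (M x)⁻¹ i j) s := by
  simp only [Matrix.inv_def, Ring.inverse_eq_inv', Matrix.smul_apply, smul_eq_mul,
    Matrix.adjugate_apply]
  refine ((contDiffOn_det hM).inv fun x hx => (hu x hx).ne_zero).mul (contDiffOn_det fun a b => ?_)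
  by_cases h : a = j
  · subst h
    simpa using contDiffOn_const
  · simpa [Matrix.updateRow_ne h] using hM a b

/-- Product rule for matrix curves differentiated entrywise. -/
lemma hasDerivAt_matrix_mul {M N : ℝ → Matrix (Fin 3) (Fin 3) ℝ}
    {M' N' : Matrix (Fin 3) (Fin 3) ℝ} {t : ℝ}
    (hM : ∀ i j, HasDerivAt (fun s => M s i j) (M' i j) t)
    (hN : ∀ i j, HasDerivAt (fun s => N s i j) (N' i j) t) (i j : Fin 3) :
    HasDerivAt (fun s => (M s * N s) i j) ((M' * N t + M t * N') i j) t := by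
  simp only [Matrix.mul_apply, Matrix.add_apply, ← Finset.sum_add_distrib]
  exact HasDerivAt.fun_sum fun k _ => (hM i k).mul (hN k j)

lemma hasDerivAt_matrix_inv {M : ℝ → Matrix (Fin 3) (Fin 3) ℝ}
    {M' : Matrix (Fin 3) (Fin 3) ℝ} {t : ℝ}
    (hM : ∀ i j, HasDerivAt (fun s => M s i j) (M' i j) t)
    (hd : ∀ i j, DifferentiableAt ℝ (fun s => (M s)⁻¹ i j) t)
    (hu : ∀ᶠ s in nhds t, IsUnit (M s).det) (i j : Fin 3) :
    HasDerivAt (fun s => (M s)⁻¹ i j) ((-((M t)⁻¹ * M' * (M t)⁻¹)) i j) t := by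
  let N' : Matrix (Fin 3) (Fin 3) ℝ := Matrix.of fun i j => deriv (fun s => (M s)⁻¹ i j) t
  have hN : ∀ i j, HasDerivAt (fun s => (M s)⁻¹ i j) (N' i j) t := fun i j => (hd i j).hasDerivAt
  have hz : M' * (M t)⁻¹ + M t * N' = 0 := by
    ext a b
    refine (hasDerivAt_matrix_mul hM hN a b).unique ?_
    refine (hasDerivAt_const t ((1 : Matrix (Fin 3) (Fin 3) ℝ) a b)).congr_of_eventuallyEq ?_
    filter_upwards [hu] with s hs
    rw [Matrix.mul_nonsing_inv _ hs]
  have hN' : N' = -((M t)⁻¹ * M' * (M t)⁻¹) := by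
    have h := congrArg ((M t)⁻¹ * ·) hz
    simp only [Matrix.mul_add, Matrix.mul_zero, ← Matrix.mul_assoc,
      Matrix.nonsing_inv_mul _ hu.self_of_nhds, Matrix.one_mul] at h
    exact eq_neg_of_add_eq_zero_right h
  exact hN' ▸ hN i j

/-- If `∇f = (∇φ)ᵀ h`, then `(∇h)(∇φ)⁻¹` is symmetric: a Lagrangian gradient is Lagrangian
curl-free. -/
lemma isSymm_grad_mul_inv {φ h : (Fin 3 → ℝ) → Fin 3 → ℝ} {f : (Fin 3 → ℝ) → ℝ}
    {x : Fin 3 → ℝ} {M P : Matrix (Fin 3) (Fin 3) ℝ}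
    (hφ : ∀ i, ContDiffAt ℝ 2 (fun y => φ y i) x) (hf : ContDiffAt ℝ 2 f x)
    (hh : ∀ i, DifferentiableAt ℝ (fun y => h y i) x)
    (hM : ∀ i k, M i k = pd k (fun y => φ y i) x)
    (hP : ∀ i k, P i k = pd k (fun y => h y i) x) (hu : IsUnit M.det)
    (hrel : ∀ s, pd s f =ᶠ[nhds x] fun y => ∑ k, pd s (fun z => φ z k) y * h y k) :
    (P * M⁻¹).IsSymm := by
  have hexp : ∀ r s, pd r (pd s f) x
      = ∑ k, (pd r (pd s fun z => φ z k) x * h x k) + (Mᵀ * P) s r := fun r s => by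
    have hp : ∀ k, HasFDerivAt (pd s fun z => φ z k) (fderiv ℝ (pd s fun z => φ z k) x) x :=
      fun k => ((contDiffAt_pd (n := 1) (by simpa [one_add_one_eq_two] using hφ k) s).differentiableAt
        (by simp)).hasFDerivAt
    have := HasFDerivAt.fun_sum (u := Finset.univ)
      fun k _ => (hp k).fun_mul (hh k).hasFDerivAt
    have h0 : pd r (pd s f) x = pd r (fun y => ∑ k, pd s (fun z => φ z k) y * h y k) x := by
      rw [pd, (hrel s).fderiv_eq, pd]
    rw [h0, pd, this.fderiv, Matrix.mul_apply, ← Finset.sum_add_distrib]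
    simp only [_root_.sum_apply, _root_.add_apply,
      _root_.smul_apply, smul_eq_mul, Matrix.transpose_apply, hM, hP]
    exact Finset.sum_congr rfl fun k _ => by simp only [pd]; ring
  have hsym : (Mᵀ * P)ᵀ = Mᵀ * P := by
    ext r s
    have h1 := hexp r s
    rw [pd_comm hf, hexp s r] at h1
    simp only [fun k => pd_comm (hφ k) s r] at h1
    simpa using (add_left_cancel h1).symm
  have hu' : IsUnit Mᵀ.det := by rwa [Matrix.det_transpose]
  have key : P * M⁻¹ = (M⁻¹)ᵀ * (Mᵀ * P) * M⁻¹ := by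
    rw [Matrix.transpose_nonsing_inv, ← Matrix.mul_assoc, Matrix.nonsing_inv_mul _ hu',
      Matrix.one_mul]
  rw [Matrix.IsSymm, key, Matrix.transpose_mul, Matrix.transpose_mul, hsym,
    Matrix.transpose_transpose]
  simp only [Matrix.mul_assoc]

/-- The axial vector `ε_{ijk} W_{kj}` of a matrix. -/
def axial (W : Matrix (Fin 3) (Fin 3) ℝ) (i : Fin 3) : ℝ := ∑ j, ∑ k, eps i j k * W k j

lemma eps_swap (i j k : Fin 3) : eps i j k = -eps i k j := by
  simp only [eps]; ring

lemma axial_eq_zero {W : Matrix (Fin 3) (Fin 3) ℝ} (hW : W.IsSymm) (i : Fin 3) :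
    axial W i = 0 := by
  have h : axial W i = -axial W i := by
    conv_lhs => rw [axial, Finset.sum_comm]
    simp only [axial, ← Finset.sum_neg_distrib]
    refine Finset.sum_congr rfl fun j _ => Finset.sum_congr rfl fun k _ => ?_
    rw [eps_swap, hW.apply]; ring
  linarith

lemma axial_add (W W' : Matrix (Fin 3) (Fin 3) ℝ) (i : Fin 3) :
    axial (W + W') i = axial W i + axial W' i := by
  simp only [axial, Matrix.add_apply, mul_add, Finset.sum_add_distrib]

lemma axial_smul (c : ℝ) (W : Matrix (Fin 3) (Fin 3) ℝ) (i : Fin 3) :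
    axial (c • W) i = c * axial W i := by
  simp only [axial, Matrix.smul_apply, smul_eq_mul, Finset.mul_sum]
  exact Finset.sum_congr rfl fun j _ => Finset.sum_congr rfl fun k _ => by ring

lemma axial_neg (W : Matrix (Fin 3) (Fin 3) ℝ) (i : Fin 3) : axial (-W) i = -axial W i := by
  simpa using axial_smul (-1) W i

lemma sum_eps_swap (W : Matrix (Fin 3) (Fin 3) ℝ) (i : Fin 3) :
    ∑ k, ∑ j, eps i k j * W k j = -axial W i := by
  rw [Finset.sum_comm]
  simp only [axial, ← Finset.sum_neg_distrib]
  exact Finset.sum_congr rfl fun j _ => Finset.sum_congr rfl fun k _ => by rw [eps_swap]; ring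

lemma hasDerivAt_axial {W : ℝ → Matrix (Fin 3) (Fin 3) ℝ} {W' : Matrix (Fin 3) (Fin 3) ℝ} {t : ℝ}
    (hW : ∀ i j, HasDerivAt (fun s => W s i j) (W' i j) t) (i : Fin 3) :
    HasDerivAt (fun s => axial (W s) i) (axial W' i) t := by
  unfold axial
  exact HasDerivAt.fun_sum fun j _ => HasDerivAt.fun_sum fun k _ => (hW k j).const_mul _

lemma continuousOn_matrix_time {N : (Fin 3 → ℝ) → ℝ → Matrix (Fin 3) (Fin 3) ℝ}
    {n : WithTop ℕ∞} (hN : ∀ i k, ContDiffOn ℝ n (fun p : (Fin 3 → ℝ) × ℝ => N p.1 p.2 i k)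
      (ball3 ×ˢ Ici 0)) {x : Fin 3 → ℝ} (hx : x ∈ ball3) :
    ContinuousOn (fun s => N x s) (Ici 0) :=
  continuousOn_pi.2 fun i => continuousOn_pi.2 fun k =>
    (hN i k).continuousOn.comp (f := fun s : ℝ => (x, s)) (by fun_prop) fun _ hs => ⟨hx, hs⟩

lemma continuousOn_axial {W : ℝ → Matrix (Fin 3) (Fin 3) ℝ} {s : Set ℝ}
    (hW : ContinuousOn W s) (i : Fin 3) : ContinuousOn (fun t => axial (W t) i) s := by
  unfold axial
  exact continuousOn_finsetSum _ fun j _ => continuousOn_finsetSum _ fun k _ =>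
    continuousOn_const.mul ((continuous_apply_apply k j).comp_continuousOn hW)

/-- The symmetry of `(α⁵ ∇v_t + 2α⁴α' ∇v + ∇η) (∇η)⁻¹` expressed by the momentum equation. -/
lemma isSymm_of_momentum {φ w wt : (Fin 3 → ℝ) → Fin 3 → ℝ}
    {M : (Fin 3 → ℝ) → Matrix (Fin 3) (Fin 3) ℝ} {a b : ℝ} {x : Fin 3 → ℝ} (hx : x ∈ ball3)
    (hM : ∀ y i k, M y i k = pd k (fun z => φ z i) y)
    (hφ : ∀ y ∈ ball3, ∀ i, ContDiffAt ℝ 3 (fun z => φ z i) y)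
    (hw : ∀ i, DifferentiableAt ℝ (fun z => w z i) x)
    (hwt : ∀ i, DifferentiableAt ℝ (fun z => wt z i) x)
    (hu : ∀ y ∈ ball3, IsUnit (M y).det)
    (hmom : ∀ y ∈ ball3, ∀ i, a * wt y i + b * w y i + φ y i
      + 2 * ∑ k, (M y)⁻¹ k i * pd k (fun z => dw z * ((M z).det)⁻¹) y = 0) :
    ((a • Matrix.of (fun i k => pd k (fun z => wt z i) x)
      + b • Matrix.of (fun i k => pd k (fun z => w z i) x) + M x) * (M x)⁻¹).IsSymm := by
  have hf : ContDiffOn ℝ 2 (fun z => dw z * ((M z).det)⁻¹) ball3 := by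
    have hdw : ContDiff ℝ 2 dw := by unfold dw; fun_prop
    refine hdw.contDiffOn.mul (ContDiffOn.inv (contDiffOn_det fun i k => ?_)
      fun y hy => (hu y hy).ne_zero)
    intro y hy
    simp only [hM]
    exact (contDiffAt_pd (n := 2) (hφ y hy i) k).contDiffWithinAt
  have hf' : ∀ y ∈ ball3, ContDiffAt ℝ 2 (fun z => dw z * ((M z).det)⁻¹) y := fun y hy =>
    hf.contDiffAt (isOpen_ball3.mem_nhds hy)
  have hφd : ∀ i, DifferentiableAt ℝ (fun z => φ z i) x := fun i =>
    (hφ x hx i).differentiableAt (by simp)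
  refine isSymm_grad_mul_inv (h := fun y i => a * wt y i + b * w y i + φ y i)
    (f := fun y => -2 * (dw y * ((M y).det)⁻¹))
    (fun i => (hφ x hx i).of_le (by norm_num)) (contDiffAt_const.mul (hf' x hx))
    (fun i => (((hwt i).const_mul a).add ((hw i).const_mul b)).add (hφd i)) (hM x) ?_ (hu x hx) ?_
  · intro i k
    have := ((((hwt i).hasFDerivAt.const_mul a).fun_add ((hw i).hasFDerivAt.const_mul b)).fun_add
      (hφd i).hasFDerivAt).fderiv
    simp [pd, this, hM]
  · intro s
    filter_upwards [isOpen_ball3.mem_nhds hx] with y hy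
    let g : Fin 3 → ℝ := fun k => pd k (fun z => dw z * ((M z).det)⁻¹) y
    let h : Fin 3 → ℝ := fun i => a * wt y i + b * w y i + φ y i
    have hh : h = (-2 : ℝ) • (((M y)⁻¹)ᵀ *ᵥ g) := by
      ext i
      have := hmom y hy i
      simp only [h, g, Pi.smul_apply, Matrix.mulVec, dotProduct, Matrix.transpose_apply,
        smul_eq_mul]
      linarith
    have h1 : (M y)ᵀ *ᵥ h = (-2 : ℝ) • g := by
      rw [hh, Matrix.mulVec_smul, Matrix.mulVec_mulVec, ← Matrix.transpose_mul,
        Matrix.nonsing_inv_mul _ (hu y hy), Matrix.transpose_one, Matrix.one_mulVec]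
    have h2 : pd s (fun z => -2 * (dw z * ((M z).det)⁻¹)) y = -2 * g s := by
      have := ((((hf' y hy).differentiableAt (by simp)).hasFDerivAt).const_mul (-2)).fderiv
      rw [pd, this]
      rfl
    rw [h2]
    have := congrFun h1 s
    simp only [Matrix.mulVec, dotProduct, Matrix.transpose_apply, Pi.smul_apply, smul_eq_mul,
      hM] at this
    exact this.symm

/-- Evolution of the Lagrangian curl of the velocity for the `γ = 2` momentum equation
`α⁵ ∂_t vⁱ + 2α⁴α' vⁱ + ηⁱ + 2 Aᵏᵢ ∂_k(d J⁻¹) = 0`: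
`α(t)² (curl_η v)ᵢ = (curl u₀)ᵢ + ∫₀ᵗ α² ε_{ikj} ∂_r vᵏ Aʳₗ ∂_m vˡ Aᵐⱼ ds`. -/
theorem stmt15 (α α' : ℝ → ℝ)
    (hαpos : ∀ t ∈ Ici (0 : ℝ), 0 < α t) (hα0 : α 0 = 1)
    (hα : ∀ t ∈ Ici (0 : ℝ), HasDerivWithinAt α (α' t) (Ici 0) t)
    (hα'c : ContinuousOn α' (Ici 0))
    (η v vt : (Fin 3 → ℝ) → ℝ → Fin 3 → ℝ)
    (hη0 : ∀ x ∈ ball3, η x 0 = x)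
    (hsmooth : ContDiffOn ℝ 3 (fun p : (Fin 3 → ℝ) × ℝ => η p.1 p.2) (ball3 ×ˢ Ici 0))
    (hv : ∀ x ∈ ball3, ∀ t ∈ Ici (0 : ℝ), HasDerivWithinAt (fun s => η x s) (v x t) (Ici 0) t)
    (hvt : ∀ x ∈ ball3, ∀ t ∈ Ici (0 : ℝ), HasDerivWithinAt (fun s => v x s) (vt x t) (Ici 0) t)
    (hinv : ∀ x ∈ ball3, ∀ t ∈ Ici (0 : ℝ), IsUnit (jacT η x t).det)
    (hmom : ∀ x ∈ ball3, ∀ t > (0 : ℝ), ∀ i : Fin 3,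
      α t ^ 5 * vt x t i + 2 * α t ^ 4 * α' t * v x t i + η x t i
        + 2 * ∑ k, (jacT η x t)⁻¹ k i *
            pd k (fun y => dw y * ((jacT η y t).det)⁻¹) x = 0) :
    ∀ t ∈ Ici (0 : ℝ), ∀ x ∈ ball3, ∀ i : Fin 3,
      α t ^ 2 * (∑ j, ∑ k, ∑ r, eps i j k * (jacT η x t)⁻¹ r j *
          pd r (fun y => v y t k) x)
        = (∑ j, ∑ k, eps i j k * pd j (fun y => v y 0 k) x)
          + ∫ s in (0 : ℝ)..t, α s ^ 2 *
              ∑ k, ∑ j, ∑ r, ∑ l, ∑ m, eps i k j *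
                pd r (fun y => v y s k) x * (jacT η x s)⁻¹ r l *
                pd m (fun y => v y s l) x * (jacT η x s)⁻¹ m j := by
  intro t ht x hx i
  have cη : ∀ i, ContDiffOn ℝ 3 (fun p : (Fin 3 → ℝ) × ℝ => η p.1 p.2 i) (ball3 ×ˢ Ici 0) :=
    fun i => contDiffOn_pi.1 hsmooth i
  have dη := fun i x hx t ht => hasDerivWithinAt_pi.1 (hv x hx t ht) i
  have dv := fun i x hx t ht => hasDerivWithinAt_pi.1 (hvt x hx t ht) i
  have cv : ∀ i, ContDiffOn ℝ 2 (fun p : (Fin 3 → ℝ) × ℝ => v p.1 p.2 i) (ball3 ×ˢ Ici 0) :=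
    fun i => contDiffOn_timeDeriv (n := 2) (cη i) (dη i)
  have cvt : ∀ i, ContDiffOn ℝ 1 (fun p : (Fin 3 → ℝ) × ℝ => vt p.1 p.2 i) (ball3 ×ˢ Ici 0) :=
    fun i => contDiffOn_timeDeriv (n := 1) (cv i) (dv i)
  have cM : ∀ i k, ContDiffOn ℝ 2 (fun p : (Fin 3 → ℝ) × ℝ => jacT η p.1 p.2 i k)
      (ball3 ×ˢ Ici 0) := fun i k => contDiffOn_pd (n := 2) (cη i) k
  have cV : ∀ i k, ContDiffOn ℝ 1 (fun p : (Fin 3 → ℝ) × ℝ => jacT v p.1 p.2 i k)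
      (ball3 ×ˢ Ici 0) := fun i k => contDiffOn_pd (n := 1) (cv i) k
  have cA : ∀ i k, ContDiffOn ℝ 2 (fun p : (Fin 3 → ℝ) × ℝ => (jacT η p.1 p.2)⁻¹ i k)
      (ball3 ×ˢ Ici 0) := contDiffOn_inv_apply cM fun p hp => hinv p.1 hp.1 p.2 hp.2
  have contV : ContinuousOn (fun s => jacT v x s) (Ici 0) := continuousOn_matrix_time cV hx
  have contA : ContinuousOn (fun s => (jacT η x s)⁻¹) (Ici 0) :=
    continuousOn_matrix_time (N := fun x s => (jacT η x s)⁻¹) cA hx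
  have contW : ContinuousOn (fun s => jacT v x s * (jacT η x s)⁻¹) (Ici 0) := contV.mul contA
  have contα : ContinuousOn α (Ici 0) := fun s hs => (hα s hs).continuousWithinAt
  have hderiv : ∀ s, 0 < s → HasDerivAt
      (fun s => α s ^ 2 * axial (jacT v x s * (jacT η x s)⁻¹) i)
      (-(α s ^ 2 * axial (jacT v x s * (jacT η x s)⁻¹ * (jacT v x s * (jacT η x s)⁻¹)) i)) s := by
    intro s hs
    have hs' : s ∈ Ici (0 : ℝ) := hs.le
    have dα : HasDerivAt α (α' s) s := (hα s hs').hasDerivAt (Ici_mem_nhds hs)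
    have dM : ∀ i k, HasDerivAt (fun r => jacT η x r i k) (jacT v x s i k) s := fun i k =>
      hasDerivAt_pd (w := fun p => v p.1 p.2 i) ((cη i).of_le (by norm_num)) (dη i) k hx hs
    have dV : ∀ i k, HasDerivAt (fun r => jacT v x r i k) (jacT vt x s i k) s := fun i k =>
      hasDerivAt_pd (w := fun p => vt p.1 p.2 i) (cv i) (dv i) k hx hs
    have dA := hasDerivAt_matrix_inv dM
      (fun i k => (((cA i k).contDiffAt (ball3_prod_Ici_mem_nhds hx hs)).differentiableAt
        (by simp)).comp s (f := fun r => (x, r)) (by fun_prop))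
      (by filter_upwards [Ioi_mem_nhds hs] with r hr using hinv x hx r (mem_Ici.2 (le_of_lt hr)))
    have hsymm : ((α s ^ 5 • jacT vt x s + (2 * α s ^ 4 * α' s) • jacT v x s + jacT η x s)
        * (jacT η x s)⁻¹).IsSymm :=
      isSymm_of_momentum (M := fun y => jacT η y s) hx (fun _ _ _ => rfl)
        (fun y hy i => contDiffAt_slice (cη i) hy hs')
        (fun i => (contDiffAt_slice (cv i) hx hs').differentiableAt (by simp))
        (fun i => (contDiffAt_slice (cvt i) hx hs').differentiableAt (by simp))
        (fun y hy => hinv y hy s hs') (fun y hy => hmom y hy s hs)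
    have hax := axial_eq_zero hsymm i
    rw [Matrix.add_mul, Matrix.add_mul, Matrix.mul_nonsing_inv _ (hinv x hx s hs'), axial_add,
      axial_add, axial_eq_zero Matrix.isSymm_one, Matrix.smul_mul, Matrix.smul_mul, axial_smul,
      axial_smul, add_zero] at hax
    have hax' : α s ^ 2 * axial (jacT vt x s * (jacT η x s)⁻¹) i
        + 2 * α s * α' s * axial (jacT v x s * (jacT η x s)⁻¹) i = 0 := by
      have h3 : α s ^ 3 ≠ 0 := (pow_pos (hαpos s hs') 3).ne'
      apply mul_left_cancel₀ h3
      linear_combination hax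
    refine ((dα.fun_pow 2).fun_mul (hasDerivAt_axial (hasDerivAt_matrix_mul dV dA) i)).congr_deriv ?_
    rw [axial_add, Matrix.mul_neg, axial_neg]
    simp only [Matrix.mul_assoc]
    push_cast
    linear_combination hax'
  have hIcc : Icc 0 t ⊆ Ici (0 : ℝ) := Icc_subset_Ici_self
  have hftc := integral_eq_sub_of_hasDerivAt_of_le (mem_Ici.1 ht)
    (((contα.pow 2).mul (continuousOn_axial contW i)).mono hIcc) (fun s hs => hderiv s hs.1)
    (ContinuousOn.intervalIntegrable_of_Icc (mem_Ici.1 ht)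
      ((((contα.pow 2).mul (continuousOn_axial (contW.mul contW) i)).neg).mono hIcc))
  have hM0 : jacT η x 0 = 1 := by
    ext a b
    have he : (fun y => η y 0 a) =ᶠ[nhds x] fun y => y a := by
      filter_upwards [isOpen_ball3.mem_nhds hx] with y hy
      rw [hη0 y hy]
    have hp : HasFDerivAt (fun y : Fin 3 → ℝ => y a) (ContinuousLinearMap.proj a) x :=
      (ContinuousLinearMap.proj (R := ℝ) (φ := fun _ : Fin 3 => ℝ) a).hasFDerivAt
    simp [jacT, pd, he.fderiv_eq, hp.fderiv, Matrix.one_apply, Pi.single_apply]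
  have hcurl : ∀ s, (∑ j, ∑ k, ∑ r, eps i j k * (jacT η x s)⁻¹ r j * pd r (fun y => v y s k) x)
      = axial (jacT v x s * (jacT η x s)⁻¹) i := fun s => by
    simp only [axial, Matrix.mul_apply, Finset.mul_sum]
    refine Finset.sum_congr rfl fun j _ => Finset.sum_congr rfl fun k _ =>
      Finset.sum_congr rfl fun r _ => ?_
    simp only [jacT, Matrix.of_apply]
    ring
  have hint : ∀ s, α s ^ 2 * ∑ k, ∑ j, ∑ r, ∑ l, ∑ m, eps i k j *
        pd r (fun y => v y s k) x * (jacT η x s)⁻¹ r l *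
        pd m (fun y => v y s l) x * (jacT η x s)⁻¹ m j
      = -(α s ^ 2 * axial (jacT v x s * (jacT η x s)⁻¹ * (jacT v x s * (jacT η x s)⁻¹)) i) := by
    intro s
    rw [← mul_neg, ← sum_eps_swap]
    congr 1
    refine Finset.sum_congr rfl fun k _ => Finset.sum_congr rfl fun j _ => ?_
    simp only [Matrix.mul_apply, Finset.mul_sum, Finset.sum_mul]
    rw [Finset.sum_comm]
    refine Finset.sum_congr rfl fun l _ => ?_
    rw [Finset.sum_comm]
    refine Finset.sum_congr rfl fun m _ => Finset.sum_congr rfl fun r _ => ?_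
    simp only [jacT, Matrix.of_apply]
    ring
  have hinit : (∑ j, ∑ k, eps i j k * pd j (fun y => v y 0 k) x)
      = α 0 ^ 2 * axial (jacT v x 0 * (jacT η x 0)⁻¹) i := by
    rw [hα0, hM0, inv_one, Matrix.mul_one, one_pow, one_mul]
    rfl
  simp only [hint]
  rw [hcurl, hinit, hftc]
  simp only [Pi.mul_apply, Pi.pow_apply]
  ring
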